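/- Let n ≥ 2 and let α₁ > α₂ > … > α_n be integers such that {(α_i + α_j)/2 : 1 ≤ i ≤ j ≤ n and α_i + α_j is even} = {1, 2, …, n(n+1)/2}. Then α_n = 1 and α_{n+1−i} = 4i − 5 for all 2 ≤ i ≤ n. -/

import Mathlib

/-- If the halves of the even pair sums `α i + α j` with `i ≤ j < n` are exactly `1, …, n(n+1)/2`,
then, as there are only `n(n+1)/2` pairs, all pair sums are even and pairwise distinct. -/
theorem pair_sums_injective_of_halves_eq_Icc (n : ℕ) (α : ℕ → ℤ)
    (h : {t : ℤ | ∃ i j, i ≤ j ∧ j < n ∧ 2 * t = α i + α j}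
          = Set.Icc (1 : ℤ) ((n * (n + 1) / 2 : ℕ) : ℤ)) :
    (∀ i j, i ≤ j → j < n →
      ∃ t : ℤ, 1 ≤ t ∧ t ≤ ((n * (n + 1) / 2 : ℕ) : ℤ) ∧ 2 * t = α i + α j) ∧
    ∀ i j k l, i ≤ j → j < n → k ≤ l → l < n → α i + α j = α k + α l → i = k ∧ j = l := by
  let P : Finset (Σ _ : ℕ, ℕ) := (Finset.range n).sigma fun j ↦ Finset.range (j + 1)
  let f : (Σ _ : ℕ, ℕ) → ℤ := fun p ↦ α p.2 + α p.1
  let T : Finset ℤ :=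
    (Finset.Icc (1 : ℤ) ((n * (n + 1) / 2 : ℕ) : ℤ)).image fun t ↦ 2 * t
  have hmem : ∀ i j, i ≤ j → j < n → (⟨j, i⟩ : Σ _ : ℕ, ℕ) ∈ P := by
    intro i j hij hj
    simp only [P, Finset.mem_sigma, Finset.mem_range]
    omega
  have hP : P.card = n * (n + 1) / 2 := by
    have h1 : P.card = ∑ j ∈ Finset.range (n + 1), j := by
      rw [Finset.sum_range_succ']
      simp [P, Finset.card_sigma]
    rw [h1, Finset.sum_range_id, Nat.add_sub_cancel, mul_comm]
  have hT : T.card = n * (n + 1) / 2 := by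
    rw [Finset.card_image_of_injective _ (mul_right_injective₀ (two_ne_zero' ℤ)), Int.card_Icc]
    omega
  have hsub : T ⊆ P.image f := by
    intro s hs
    obtain ⟨t, ht, rfl⟩ := Finset.mem_image.mp hs
    obtain ⟨i, j, hij, hj, hsum⟩ := h.symm.subset (Finset.mem_Icc.mp ht)
    exact Finset.mem_image.mpr ⟨⟨j, i⟩, hmem i j hij hj, hsum.symm⟩
  have hcard : (P.image f).card ≤ T.card := by
    rw [hT, ← hP]
    exact Finset.card_image_le
  have heq : T = P.image f := Finset.eq_of_subset_of_card_le hsub hcard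
  have hinj : Set.InjOn f P := Finset.card_image_iff.mp (by rw [← heq, hT, hP])
  refine ⟨fun i j hij hj ↦ ?_, fun i j k l hij hj hkl hl hsum ↦ ?_⟩
  · have hs : f ⟨j, i⟩ ∈ T := heq ▸ Finset.mem_image_of_mem f (hmem i j hij hj)
    obtain ⟨t, ht, hft⟩ := Finset.mem_image.mp hs
    exact ⟨t, (Finset.mem_Icc.mp ht).1, (Finset.mem_Icc.mp ht).2, hft⟩
  · have hp := hinj (hmem i j hij hj) (hmem k l hkl hl) hsum
    simp only [Sigma.mk.injEq, heq_eq_eq] at hp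
    exact hp.symm


/-- If `α₁ > … > α_n` are integers with
`{(αᵢ + αⱼ)/2 : i ≤ j, αᵢ + αⱼ even} = {1, …, n(n+1)/2}`, then `α_n = 1` and
`α_{n+1-i} = 4i - 5` for all `2 ≤ i ≤ n` (indices 0-based in Lean, so
`α (n - i)` is the math `α_{n+1-i}`). -/
theorem stmt17 (n : ℕ) (hn : 2 ≤ n) (α : ℕ → ℤ)
    (hα : ∀ i j, i < j → j < n → α j < α i)
    (h : {t : ℤ | ∃ i j, i ≤ j ∧ j < n ∧ 2 * t = α i + α j}
          = Set.Icc (1 : ℤ) ((n * (n + 1) / 2 : ℕ) : ℤ)) :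
    α (n - 1) = 1 ∧ ∀ i : ℕ, 2 ≤ i → i ≤ n → α (n - i) = 4 * (i : ℤ) - 5 := by
  obtain ⟨hval, hinj⟩ := pair_sums_injective_of_halves_eq_Icc n α h
  have hN : 3 ≤ n * (n + 1) / 2 := by
    rw [Nat.le_div_iff_mul_le two_pos]
    nlinarith
  have hsur : ∀ t : ℤ, 1 ≤ t → t ≤ ((n * (n + 1) / 2 : ℕ) : ℤ) →
      ∃ i j, i ≤ j ∧ j < n ∧ 2 * t = α i + α j :=
    fun t h1 h2 ↦ h.symm.subset ⟨h1, h2⟩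
  generalize n * (n + 1) / 2 = N at *
  have hanti : ∀ i j, i ≤ j → j < n → α j ≤ α i := fun i j hij hj ↦ by
    rcases hij.eq_or_lt with rfl | hlt
    · exact le_rfl
    · exact (hα i j hlt hj).le
  have hlast : α (n - 1) = 1 := by
    obtain ⟨t, ht, -, hsum⟩ := hval (n - 1) (n - 1) le_rfl (by omega)
    obtain ⟨i, j, hij, hj, hij2⟩ := hsur 1 le_rfl (by omega)
    have h1 := hanti i (n - 1) (by omega) (by omega)
    have h2 := hanti j (n - 1) (by omega) (by omega)
    omega
  have hfirst : α 0 = N := by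
    obtain ⟨t, -, ht, hsum⟩ := hval 0 0 le_rfl (by omega)
    obtain ⟨i, j, hij, hj, hij2⟩ := hsur N (by omega) le_rfl
    have h1 := hanti 0 i (by omega) (by omega)
    have h2 := hanti 0 j (by omega) (by omega)
    omega
  have hsecond : α 1 = N - 2 := by
    obtain ⟨t, -, -, hsum⟩ := hval 0 1 zero_le_one (by omega)
    have hlt := hα 0 1 zero_lt_one (by omega)
    obtain ⟨i, j, hij, hj, hij2⟩ := hsur (N - 1) (by omega) (by omega)
    have h1 := hanti 0 i (by omega) (by omega)
    have hj0 : 1 ≤ j := by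
      by_contra! hj0
      obtain rfl : j = 0 := by omega
      obtain rfl : i = 0 := by omega
      omega
    have h2 := hanti 1 j hj0 hj
    omega
  have hpenult : α (n - 2) = 3 := by
    obtain ⟨t, -, -, hsum⟩ := hval (n - 2) (n - 1) (by omega) (by omega)
    have hlt := hα (n - 2) (n - 1) (by omega) (by omega)
    obtain ⟨i, j, hij, hj, hij2⟩ := hsur 2 (by omega) (by omega)
    have h1 := hanti j (n - 1) (by omega) (by omega)
    have hi : i ≤ n - 2 := by
      by_contra! hi
      obtain rfl : i = n - 1 := by omega
      obtain rfl : j = n - 1 := by omega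
      omega
    have h2 := hanti i (n - 2) hi (by omega)
    omega
  refine ⟨hlast, fun i hi hin ↦ ?_⟩
  -- For `n ≥ 3` the pairs `(0, n - 1)` and `(1, n - 2)` have equal sums, so only `n = 2` occurs.
  obtain rfl : n = 2 := by
    by_contra hne
    have := hinj 0 (n - 1) 1 (n - 2) (by omega) (by omega) (by omega) (by omega) (by omega)
    omega
  obtain rfl : i = 2 := by omega
  simpa using hpenult
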